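/- Let p > 3 be prime. Among regular subgroups G of Hol(M₁) with |Θ(G)| = p², the conjugation action of Aut(M₁) has exactly (2p − 3)p orbits consisting of subgroups isomorphic to M₁, and exactly 2p − 1 orbits consisting of subgroups isomorphic to the elementary abelian group (ZMod p)³. -/

import Mathlib

/-! ## The Heisenberg group of order `p³` -/

@[ext]
structure Heisenberg (p : ℕ) where
  x : ZMod p
  y : ZMod p
  z : ZMod p

namespace Heisenberg

variable {p : ℕ}

instance : Mul (Heisenberg p) :=
  ⟨fun g h => ⟨g.x + h.x, g.y + h.y, g.z + h.z + h.x * g.y⟩⟩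

instance : One (Heisenberg p) := ⟨⟨0, 0, 0⟩⟩

instance : Inv (Heisenberg p) := ⟨fun g => ⟨-g.x, -g.y, -g.z + g.x * g.y⟩⟩

@[simp] theorem mul_x (g h : Heisenberg p) : (g * h).x = g.x + h.x := rfl
@[simp] theorem mul_y (g h : Heisenberg p) : (g * h).y = g.y + h.y := rfl
@[simp] theorem mul_z (g h : Heisenberg p) : (g * h).z = g.z + h.z + h.x * g.y := rfl
@[simp] theorem one_x : (1 : Heisenberg p).x = 0 := rfl
@[simp] theorem one_y : (1 : Heisenberg p).y = 0 := rfl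
@[simp] theorem one_z : (1 : Heisenberg p).z = 0 := rfl
@[simp] theorem inv_x (g : Heisenberg p) : (g⁻¹).x = -g.x := rfl
@[simp] theorem inv_y (g : Heisenberg p) : (g⁻¹).y = -g.y := rfl
@[simp] theorem inv_z (g : Heisenberg p) : (g⁻¹).z = -g.z + g.x * g.y := rfl

instance : Group (Heisenberg p) where
  mul_assoc a b c := by ext <;> simp <;> ring
  one_mul a := by ext <;> simp
  mul_one a := by ext <;> simp
  inv_mul_cancel a := by ext <;> simp <;> ring

/-- The generator `ρ` (a generator of the centre). -/
def ρ : Heisenberg p := ⟨0, 0, 1⟩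

/-- The generator `σ`. -/
def σ : Heisenberg p := ⟨1, 0, 0⟩

/-- The generator `τ`. -/
def τ : Heisenberg p := ⟨0, 1, 0⟩

/-- The automorphism `α₁` determined by `σ ↦ ρσ`, `τ ↦ τ` (and `ρ ↦ ρ`). -/
def α₁ : MulAut (Heisenberg p) where
  toFun g := ⟨g.x, g.y, g.z + g.x⟩
  invFun g := ⟨g.x, g.y, g.z - g.x⟩
  left_inv g := by ext <;> simp
  right_inv g := by ext <;> simp
  map_mul' g h := by ext <;> simp <;> ring

/-- The automorphism `α₃` determined by `σ ↦ σ`, `τ ↦ ρτ` (and `ρ ↦ ρ`). -/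
def α₃ : MulAut (Heisenberg p) where
  toFun g := ⟨g.x, g.y, g.z + g.y⟩
  invFun g := ⟨g.x, g.y, g.z - g.y⟩
  left_inv g := by ext <;> simp
  right_inv g := by ext <;> simp
  map_mul' g h := by ext <;> simp <;> ring

/-- The automorphism `α₂` determined by `σ ↦ στ`, `τ ↦ τ` (and `ρ ↦ ρ`), for `p` an odd
prime. -/
def α₂ (p : ℕ) [Fact p.Prime] (hp : p ≠ 2) : MulAut (Heisenberg p) where
  toFun g := ⟨g.x, g.x + g.y, g.z + g.x * (g.x - 1) / 2⟩
  invFun g := ⟨g.x, g.y - g.x, g.z - g.x * (g.x - 1) / 2⟩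
  left_inv g := by ext <;> simp <;> ring
  right_inv g := by ext <;> simp <;> ring
  map_mul' g h := by
    have h2 : (2 : ZMod p) ≠ 0 := by
      intro h
      have h' : ((2 : ℕ) : ZMod p) = 0 := by exact_mod_cast h
      rw [CharP.cast_eq_zero_iff (ZMod p) p 2] at h'
      have h1 := Nat.le_of_dvd (by norm_num) h'
      have h2 := (Fact.out : p.Prime).two_le
      omega
    ext <;> simp
    · ring
    · field_simp
      ring

end Heisenberg

open Heisenberg

/-! ## The holomorph of `M₁` inside the permutation group -/

/-- The left regular representation `M₁ → Perm M₁`. -/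
def leftMulHom (p : ℕ) : Heisenberg p →* Equiv.Perm (Heisenberg p) :=
  MulAction.toPermHom (Heisenberg p) (Heisenberg p)

/-- The holomorph of `M₁`, realized as the subgroup of `Perm M₁` generated by left
translations and automorphisms of `M₁`. -/
def Hol (p : ℕ) : Subgroup (Equiv.Perm (Heisenberg p)) :=
  (leftMulHom p).range ⊔
    (MulAut.toPerm (Heisenberg p)).range

/-- A subgroup of `Perm X` is regular if it acts freely and transitively on `X`. -/
def IsRegularSub {X : Type*} (H : Subgroup (Equiv.Perm X)) : Prop :=
  ∀ x y : X, ∃! g : Equiv.Perm X, g ∈ H ∧ g x = y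

/-- The canonical projection `Θ : Hol(M₁) → Aut(M₁)` (with kernel the left translations),
written as a function on permutations: it sends `π` to `m ↦ (π 1)⁻¹ * π m`; on elements of the
holomorph, this is exactly the automorphism component. -/
def theta (p : ℕ) (π : Equiv.Perm (Heisenberg p)) : Equiv.Perm (Heisenberg p) :=
  (Equiv.mulLeft (π 1))⁻¹ * π

/-- The cardinality of the image `Θ(G)` of a subgroup `G` of the holomorph under the canonical
projection `Θ`. -/
noncomputable def thetaCard (p : ℕ) (G : Subgroup (Equiv.Perm (Heisenberg p))) : ℕ :=
  Nat.card (theta p '' (G : Set (Equiv.Perm (Heisenberg p))))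

/-- The conjugation action of `Aut(M₁)` (viewed inside `Perm M₁`) on subgroups of `Perm M₁`. -/
def autConj (p : ℕ) (α : MulAut (Heisenberg p)) (G : Subgroup (Equiv.Perm (Heisenberg p))) :
    Subgroup (Equiv.Perm (Heisenberg p)) :=
  Subgroup.map (MulAut.conj (MulAut.toPerm (Heisenberg p) α)).toMonoidHom G


/-- `G` is a regular subgroup of `Hol(M₁)` isomorphic to `M₁` whose image under the canonical
projection `Θ : Hol(M₁) → Aut(M₁)` has cardinality `r`. -/
def condM1 (p r : ℕ) (G : Subgroup (Equiv.Perm (Heisenberg p))) : Prop :=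
  G ≤ Hol p ∧ IsRegularSub G ∧ thetaCard p G = r ∧ Nonempty (G ≃* Heisenberg p)

/-- `G` is a regular subgroup of `Hol(M₁)`, elementary abelian of order `p³`, whose image under
the canonical projection `Θ : Hol(M₁) → Aut(M₁)` has cardinality `r`. -/
def condEA (p r : ℕ) (G : Subgroup (Equiv.Perm (Heisenberg p))) : Prop :=
  G ≤ Hol p ∧ IsRegularSub G ∧ thetaCard p G = r ∧
    Nonempty (G ≃* Multiplicative (ZMod p × ZMod p × ZMod p))



namespace Heisenberg

variable {p : ℕ}

theorem pow_eq (g : Heisenberg p) (n : ℕ) :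
    g ^ n = ⟨n * g.x, n * g.y, n * g.z + (n.choose 2 : ℕ) * (g.x * g.y)⟩ := by
  induction n with
  | zero => ext <;> simp
  | succ n ih =>
    rw [pow_succ, ih]
    ext
    · simp; ring
    · simp; ring
    · simp [Nat.choose_succ_succ' n 1]; ring

section Prime

variable [hp : Fact p.Prime]

/-- `Heisenberg p` as a product of three copies of `ZMod p`. -/
def equivProd : Heisenberg p ≃ (ZMod p × ZMod p) × ZMod p where
  toFun g := ((g.x, g.y), g.z)
  invFun v := ⟨v.1.1, v.1.2, v.2⟩
  left_inv _ := rfl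
  right_inv _ := rfl

instance : Finite (Heisenberg p) := Finite.of_equiv _ equivProd.symm

theorem two_ne_zero_of_gt (h3 : 3 < p) : (2 : ZMod p) ≠ 0 := by
  have h : ((2 : ℕ) : ZMod p) ≠ 0 := by
    rw [Ne, ZMod.natCast_eq_zero_iff]
    exact fun h => absurd (Nat.le_of_dvd (by norm_num) h) (by omega)
  exact_mod_cast h

theorem three_ne_zero_of_gt (h3 : 3 < p) : (3 : ZMod p) ≠ 0 := by
  have h : ((3 : ℕ) : ZMod p) ≠ 0 := by
    rw [Ne, ZMod.natCast_eq_zero_iff]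
    exact fun h => absurd (Nat.le_of_dvd (by norm_num) h) (by omega)
  exact_mod_cast h

/-- The endomorphism with linear part `!![m, n; r, s]` on the abelianization, translated by the
central functional `(x, y) ↦ f * x + k * y`. -/
def endo (h2 : (2 : ZMod p) ≠ 0) (m n r s f k : ZMod p) : Heisenberg p →* Heisenberg p where
  toFun g := ⟨m * g.x + n * g.y, r * g.x + s * g.y,
    (m * s - n * r) * (g.z - g.x * g.y / 2)
      + (m * g.x + n * g.y) * (r * g.x + s * g.y) / 2 + f * g.x + k * g.y⟩
  map_one' := by ext <;> simp
  map_mul' g h := by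
    ext
    · simp; ring
    · simp; ring
    · simp; field_simp; ring

theorem hom_ext {φ ψ : Heisenberg p →* Heisenberg p} (hσ : φ σ = ψ σ) (hτ : φ τ = ψ τ) :
    φ = ψ := by
  have hρ : (ρ : Heisenberg p) = τ * σ * τ⁻¹ * σ⁻¹ := by
    ext <;> simp [ρ, σ, τ]
  ext1 g
  have hg : g = σ ^ g.x.val * τ ^ g.y.val * ρ ^ g.z.val := by
    rw [pow_eq, pow_eq, pow_eq]
    ext <;> simp [ρ, σ, τ]
  rw [hg, hρ]
  simp only [map_mul, map_pow, map_inv, hσ, hτ]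

/-- The automorphism underlying `endo` when the linear part is invertible. -/
noncomputable def auto (h2 : (2 : ZMod p) ≠ 0) (m n r s f k : ZMod p)
    (hd : m * s - n * r ≠ 0) : MulAut (Heisenberg p) :=
  MulEquiv.ofBijective (endo h2 m n r s f k) <| by
    refine Function.Injective.bijective_of_finite <| (injective_iff_map_eq_one _).2 fun g hg => ?_
    have hx : m * g.x + n * g.y = 0 := congrArg Heisenberg.x hg
    have hy : r * g.x + s * g.y = 0 := congrArg Heisenberg.y hg
    have hz : (m * s - n * r) * (g.z - g.x * g.y / 2)
      + (m * g.x + n * g.y) * (r * g.x + s * g.y) / 2 + f * g.x + k * g.y = 0 :=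
      congrArg Heisenberg.z hg
    have hx0 : g.x = 0 := (mul_eq_zero.1 (show (m * s - n * r) * g.x = 0 by
      linear_combination s * hx - n * hy)).resolve_left hd
    have hy0 : g.y = 0 := (mul_eq_zero.1 (show (m * s - n * r) * g.y = 0 by
      linear_combination m * hy - r * hx)).resolve_left hd
    rw [hx0, hy0] at hz
    have hz0 : g.z = 0 := by simpa [hd] using hz
    ext <;> assumption

theorem auto_apply (h2 : (2 : ZMod p) ≠ 0) (m n r s f k : ZMod p) (hd : m * s - n * r ≠ 0)
    (g : Heisenberg p) : auto h2 m n r s f k hd g = ⟨m * g.x + n * g.y, r * g.x + s * g.y,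
    (m * s - n * r) * (g.z - g.x * g.y / 2)
      + (m * g.x + n * g.y) * (r * g.x + s * g.y) / 2 + f * g.x + k * g.y⟩ := rfl

theorem exists_eq_auto (h2 : (2 : ZMod p) ≠ 0) (φ : MulAut (Heisenberg p)) :
    ∃ m n r s f k, ∃ hd : m * s - n * r ≠ 0, φ = auto h2 m n r s f k hd := by
  obtain ⟨m, r, f, hσ⟩ : ∃ m r f, φ σ = ⟨m, r, f⟩ := ⟨_, _, _, rfl⟩
  obtain ⟨n, s, k, hτ⟩ : ∃ n s k, φ τ = ⟨n, s, k⟩ := ⟨_, _, _, rfl⟩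
  have key : φ.toMonoidHom = endo h2 m n r s (f - m * r / 2) (k - n * s / 2) := by
    apply hom_ext
    · change φ σ = _
      rw [hσ]
      ext <;> simp [endo, σ]
    · change φ τ = _
      rw [hτ]
      ext <;> simp [endo, τ]
  have hd : m * s - n * r ≠ 0 := by
    intro h
    have h1 : φ ρ = φ 1 := by
      have := DFunLike.congr_fun key ρ
      rw [map_one]
      refine Eq.trans this ?_
      ext <;> simp [endo, ρ, h]
    have := congrArg Heisenberg.z (φ.injective h1)
    simp [ρ] at this
  exact ⟨m, n, r, s, _, _, hd, MulEquiv.ext fun g => DFunLike.congr_fun key g⟩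

/-- The automorphisms acting unipotently, with `τ` fixed modulo the centre. -/
def uni (h2 : (2 : ZMod p) ≠ 0) (a b c : ZMod p) : MulAut (Heisenberg p) where
  toFun g := ⟨g.x, g.y + a * g.x, g.z + a * g.x ^ 2 / 2 + b * g.x + c * g.y⟩
  invFun g := ⟨g.x, g.y - a * g.x, g.z - a * g.x ^ 2 / 2 + (c * a - b) * g.x - c * g.y⟩
  left_inv g := by ext <;> simp <;> ring
  right_inv g := by ext <;> simp <;> ring
  map_mul' g h := by
    ext
    · simp
    · simp; ring
    · simp; field_simp; ring

theorem uni_apply (h2 : (2 : ZMod p) ≠ 0) (a b c : ZMod p) (g : Heisenberg p) :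
    uni h2 a b c g = ⟨g.x, g.y + a * g.x, g.z + a * g.x ^ 2 / 2 + b * g.x + c * g.y⟩ := rfl

theorem uni_mul (h2 : (2 : ZMod p) ≠ 0) (a b c a' b' c' : ZMod p) :
    uni h2 a b c * uni h2 a' b' c' = uni h2 (a + a') (b + b' + c * a') (c + c') := by
  ext g <;> simp [uni_apply] <;> ring

theorem uni_inj (h2 : (2 : ZMod p) ≠ 0) {a b c a' b' c' : ZMod p} :
    uni h2 a b c = uni h2 a' b' c' ↔ a = a' ∧ b = b' ∧ c = c' := by
  constructor
  · intro h
    have hy := congrArg Heisenberg.y (DFunLike.congr_fun h σ)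
    have hs := congrArg Heisenberg.z (DFunLike.congr_fun h σ)
    have ht := congrArg Heisenberg.z (DFunLike.congr_fun h τ)
    simp [uni_apply, σ, τ] at hy hs ht
    subst hy
    exact ⟨rfl, by simpa using hs, ht⟩
  · rintro ⟨rfl, rfl, rfl⟩
    rfl

end Prime

end Heisenberg

/-- A gamma function on a group: the automorphism components of a regular subgroup of the
holomorph, indexed by the images of the identity. -/
def IsGamma {M : Type*} [Group M] (γ : M → MulAut M) : Prop :=
  ∀ g h, γ (g * γ g h) = γ g * γ h

namespace IsGamma

variable {M : Type*} [Group M] {γ : M → MulAut M}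

theorem map_one (hγ : IsGamma γ) : γ 1 = 1 := by
  have h := hγ 1 1
  rw [_root_.map_one, mul_one] at h
  exact left_eq_mul.1 h

/-- The image of a gamma function, as a subgroup. -/
def image (hγ : IsGamma γ) : Subgroup (MulAut M) where
  carrier := Set.range γ
  one_mem' := ⟨1, hγ.map_one⟩
  mul_mem' := by
    rintro _ _ ⟨g, rfl⟩ ⟨h, rfl⟩
    exact ⟨_, hγ g h⟩
  inv_mem' := by
    rintro _ ⟨g, rfl⟩
    refine ⟨(γ g).symm g⁻¹, ?_⟩
    have h := hγ g ((γ g).symm g⁻¹)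
    rw [MulEquiv.apply_symm_apply, mul_inv_cancel, hγ.map_one] at h
    exact eq_inv_of_mul_eq_one_right h.symm

theorem commute (hγ : IsGamma γ) {p : ℕ} [Fact p.Prime]
    (hcard : Nat.card (Set.range γ) = p ^ 2) (g h : M) : γ g * γ h = γ h * γ g := by
  have := (IsPGroup.isMulCommutative_of_card_eq_prime_sq (G := hγ.image) hcard).is_comm.comm
    ⟨γ g, g, rfl⟩ ⟨γ h, h, rfl⟩
  exact congrArg Subtype.val this

end IsGamma

theorem ZMod.eq_mul_of_map_add {p : ℕ} {f : ZMod p → ZMod p} (hf : ∀ x y, f (x + y) = f x + f y)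
    (x : ZMod p) : f x = f 1 * x := by
  have := ZMod.map_smul (AddMonoidHom.mk' f hf) x 1
  simpa [mul_comm] using this

namespace Heisenberg

variable {p : ℕ} [Fact p.Prime]

/-- The component functions of a gamma function with unipotent values do not depend on the
central coordinate. -/
theorem central_coord_indep (h2 : (2 : ZMod p) ≠ 0) {a b c : ZMod p → ZMod p → ZMod p → ZMod p}
    (hA : ∀ x y z x' y' z', a (x + x') (y + (y' + a x y z * x'))
      (z + (z' + a x y z * x' ^ 2 / 2 + b x y z * x' + c x y z * y') + x' * y)
        = a x y z + a x' y' z')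
    (hB : ∀ x y z x' y' z', b (x + x') (y + (y' + a x y z * x'))
      (z + (z' + a x y z * x' ^ 2 / 2 + b x y z * x' + c x y z * y') + x' * y)
        = b x y z + b x' y' z' + c x y z * a x' y' z')
    (hC : ∀ x y z x' y' z', c (x + x') (y + (y' + a x y z * x'))
      (z + (z' + a x y z * x' ^ 2 / 2 + b x y z * x' + c x y z * y') + x' * y)
        = c x y z + c x' y' z')
    (hcomm : ∀ x y z x' y' z', c x y z * a x' y' z' = c x' y' z' * a x y z) (x y z : ZMod p) :
    a x y z = a x y 0 ∧ b x y z = b x y 0 ∧ c x y z = c x y 0 := by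
  have ha (x y z) : a x y z = a x y 0 + a 0 0 z := by simpa using hA x y 0 0 0 z
  have hc (x y z) : c x y z = c x y 0 + c 0 0 z := by simpa using hC x y 0 0 0 z
  have hb (x y z) : b x y z = b x y 0 + b 0 0 z + c x y 0 * a 0 0 z := by
    simpa using hB x y 0 0 0 z
  obtain ⟨a₁, ha1⟩ : ∃ a₁, ∀ z, a 0 0 z = a₁ * z :=
    ⟨_, ZMod.eq_mul_of_map_add fun z z' => by simpa using hA 0 0 z 0 0 z'⟩
  obtain ⟨c₁, hc1⟩ : ∃ c₁, ∀ z, c 0 0 z = c₁ * z :=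
    ⟨_, ZMod.eq_mul_of_map_add fun z z' => by simpa using hC 0 0 z 0 0 z'⟩
  suffices h : a₁ = 0 ∧ c₁ = 0 by
    obtain ⟨rfl, rfl⟩ := h
    simp only [zero_mul] at ha1 hc1
    obtain ⟨b₁, hb1⟩ : ∃ b₁, ∀ z, b 0 0 z = b₁ * z :=
      ⟨_, ZMod.eq_mul_of_map_add fun z z' => by simpa [ha1] using hB 0 0 z 0 0 z'⟩
    have h0 : b₁ = 0 := by
      have h := hB 0 0 1 1 0 0
      rw [hb (0 + 1)] at h
      simp only [ha1, hc1, hb1] at h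
      have h' : b₁ * b₁ = 0 := by
        simp only [mul_zero, zero_mul, add_zero, zero_add] at h
        linear_combination h
      simpa using h'
    rw [ha x y z, hb x y z, hc x y z, ha1, hc1, hb1, h0]
    simp
  by_cases hall : ∀ x y z, a x y z = 0
  · refine ⟨by simpa [ha1] using hall 0 0 1, ?_⟩
    have h := hC 0 0 1 0 1 0
    rw [hc (0 + 0)] at h
    simp only [hall, hc1] at h
    have h' : c₁ * c₁ = 0 := by
      simp only [mul_zero, zero_mul, add_zero, zero_add] at h
      linear_combination h
    simpa using h'
  push Not at hall
  obtain ⟨x₀, y₀, z₀, h₀⟩ := hall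
  obtain ⟨k, hk⟩ : ∃ k, ∀ x y z, c x y z = k * a x y z := by
    refine ⟨c x₀ y₀ z₀ / a x₀ y₀ z₀, fun x y z => ?_⟩
    field_simp
    linear_combination hcomm x y z x₀ y₀ z₀
  suffices ha0 : a₁ = 0 by
    refine ⟨ha0, ?_⟩
    have := hk 0 0 1
    rwa [ha1, hc1, ha0, zero_mul, mul_zero, mul_one] at this
  by_contra hne
  have hk0 : k = 0 := by
    have h := hA 0 0 1 0 1 0
    rw [ha (0 + 0), ha1, ha1, hk, ha1] at h
    have h' : a₁ * (k * a₁) = 0 := by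
      simp only [mul_zero, add_zero, zero_add] at h
      linear_combination h
    simpa [hne] using h'
  have hc0 (x y z) : c x y z = 0 := by rw [hk, hk0, zero_mul]
  have hy (x y) : a x y 0 = a x 0 0 + a 0 y 0 := by
    simpa [hc0] using hA x 0 0 0 y 0
  have hy1 (y) : a 0 y 0 = a 0 1 0 * y :=
    ZMod.eq_mul_of_map_add (f := fun y => a 0 y 0) (fun y y' => by
      simpa [hc0] using hA 0 y 0 0 y' 0) y
  have key (x') : a 0 1 0 * (a₁ * x') + a₁ * (a₁ * x' ^ 2 / 2 + b 0 0 1 * x') = 0 := by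
    have h := hA 0 0 1 x' 0 0
    rw [ha (0 + x'), ha1, ha1, hc0, hy (0 + x'), hy1] at h
    simp only [mul_zero, add_zero, zero_add] at h
    linear_combination h
  have h' : a₁ * a₁ = 0 := by
    have h := key 1
    have h₂ := key (-1)
    field_simp at h h₂
    have : 2 * (a₁ * a₁) = 0 := by
      linear_combination h + h₂
    simpa [h2] using this
  simp [hne] at h'

/-- Parameters for an explicit family of gamma functions. -/
structure Params (p : ℕ) where
  a : ZMod p
  b : ZMod p
  d : ZMod p
  e : ZMod p
  k : ZMod p

/-- The parameters for which the gamma function `fam` has image of order `p ^ 2`. -/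
def Params.Good (P : Params p) : Prop :=
  (P.a = 0 ∧ P.b * P.k - P.d * P.e ≠ 0) ∨ (P.a ≠ 0 ∧ P.k = 0 ∧ P.d ≠ 0)

theorem Params.Good.mul_eq_zero {P : Params p} (hP : P.Good) : P.a * P.k = 0 := by
  rcases hP with h | h
  · rw [h.1, zero_mul]
  · rw [h.2.1, mul_zero]

/-- An explicit family of gamma functions. -/
def fam (h2 : (2 : ZMod p) ≠ 0) (P : Params p) (g : Heisenberg p) : MulAut (Heisenberg p) :=
  uni h2 (P.a * g.x) (P.b * g.x + P.d * g.y + (P.e - P.d) * P.a * g.x ^ 2 / 2)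
    (P.e * g.x + P.k * g.y)

theorem isGamma_fam (h2 : (2 : ZMod p) ≠ 0) {P : Params p} (hP : P.Good) :
    IsGamma (fam h2 P) := by
  intro g h
  have hak := hP.mul_eq_zero
  rw [fam, fam, fam, uni_mul, uni_inj, uni_apply]
  refine ⟨by simp; ring, ?_, ?_⟩
  · simp only [mul_x, mul_y]
    field_simp
    linear_combination -2 * g.y * h.x * hak
  · simp only [mul_x, mul_y]
    linear_combination g.x * h.x * hak

theorem card_range_fam (h2 : (2 : ZMod p) ≠ 0) {P : Params p} (hP : P.Good) :
    Nat.card (Set.range (fam h2 P)) = p ^ 2 := by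
  have hinj : Function.Injective fun v : ZMod p × ZMod p => fam h2 P ⟨v.1, v.2, 0⟩ := by
    rintro ⟨x, y⟩ ⟨x', y'⟩ h
    obtain ⟨h₁, h₃, h₄⟩ := (uni_inj h2).1 h
    simp only at h₁ h₃ h₄
    rcases hP with ⟨ha, hd⟩ | ⟨ha, hk, hd⟩
    · simp only [ha, mul_zero, zero_mul, zero_div, add_zero] at h₃
      have hx : (P.b * P.k - P.d * P.e) * (x - x') = 0 := by
        linear_combination P.k * h₃ - P.d * h₄
      have hy : (P.b * P.k - P.d * P.e) * (y - y') = 0 := by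
        linear_combination P.b * h₄ - P.e * h₃
      rw [sub_eq_zero.1 ((mul_eq_zero.1 hx).resolve_left hd),
        sub_eq_zero.1 ((mul_eq_zero.1 hy).resolve_left hd)]
    · obtain rfl := mul_left_cancel₀ ha h₁
      rw [mul_left_cancel₀ hd (show P.d * y = P.d * y' by linear_combination h₃)]
  have hr : Set.range (fam h2 P) =
      Set.range fun v : ZMod p × ZMod p => fam h2 P ⟨v.1, v.2, 0⟩ := by
    ext φ
    constructor
    · rintro ⟨g, rfl⟩
      exact ⟨(g.x, g.y), rfl⟩
    · rintro ⟨v, rfl⟩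
      exact ⟨_, rfl⟩
  rw [hr, Nat.card_range_of_injective hinj, Nat.card_prod, Nat.card_zmod, sq]

theorem exists_eq_fam (h2 : (2 : ZMod p) ≠ 0) {γ : Heisenberg p → MulAut (Heisenberg p)}
    (hγ : IsGamma γ) (hcard : Nat.card (Set.range γ) = p ^ 2)
    (hu : ∀ g, ∃ a b c, γ g = uni h2 a b c) : ∃ P : Params p, P.Good ∧ γ = fam h2 P := by
  choose A B C hu using hu
  have hmul (g h : Heisenberg p) := by
    have := hγ g h
    rw [hu (g * γ g h), hu g, hu h, uni_mul, uni_inj, uni_apply] at this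
    exact this
  have hcomm (g h : Heisenberg p) : C g * A h = C h * A g := by
    have := hγ.commute hcard g h
    rw [hu g, hu h, uni_mul, uni_mul, uni_inj] at this
    linear_combination this.2.1
  have hind (g : Heisenberg p) := central_coord_indep h2 (a := fun x y z => A ⟨x, y, z⟩)
    (b := fun x y z => B ⟨x, y, z⟩) (c := fun x y z => C ⟨x, y, z⟩)
    (fun x y z x' y' z' => (hmul ⟨x, y, z⟩ ⟨x', y', z'⟩).1)
    (fun x y z x' y' z' => (hmul ⟨x, y, z⟩ ⟨x', y', z'⟩).2.1)
    (fun x y z x' y' z' => (hmul ⟨x, y, z⟩ ⟨x', y', z'⟩).2.2)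
    (fun x y z x' y' z' => hcomm ⟨x, y, z⟩ ⟨x', y', z'⟩) g.x g.y g.z
  obtain ⟨a, ha⟩ : ∃ a : ZMod p → ZMod p → ZMod p, ∀ g, A g = a g.x g.y :=
    ⟨fun x y => A ⟨x, y, 0⟩, fun g => (hind g).1⟩
  obtain ⟨b, hb⟩ : ∃ b : ZMod p → ZMod p → ZMod p, ∀ g, B g = b g.x g.y :=
    ⟨fun x y => B ⟨x, y, 0⟩, fun g => (hind g).2.1⟩
  obtain ⟨c, hc⟩ : ∃ c : ZMod p → ZMod p → ZMod p, ∀ g, C g = c g.x g.y :=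
    ⟨fun x y => C ⟨x, y, 0⟩, fun g => (hind g).2.2⟩
  simp only [ha, hb, hc] at hu hmul hcomm
  clear hind ha hb hc A B C
  have hA (x y x' y') : a (x + x') (y + (y' + a x y * x')) = a x y + a x' y' :=
    (hmul ⟨x, y, 0⟩ ⟨x', y', 0⟩).1
  have hB (x y x' y') : b (x + x') (y + (y' + a x y * x')) = b x y + b x' y' + c x y * a x' y' :=
    (hmul ⟨x, y, 0⟩ ⟨x', y', 0⟩).2.1
  have hC (x y x' y') : c (x + x') (y + (y' + a x y * x')) = c x y + c x' y' :=
    (hmul ⟨x, y, 0⟩ ⟨x', y', 0⟩).2.2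
  have hcomm' (x y x' y') : c x y * a x' y' = c x' y' * a x y :=
    hcomm ⟨x, y, 0⟩ ⟨x', y', 0⟩
  have hinj : Function.Injective fun v : ZMod p × ZMod p =>
      uni h2 (a v.1 v.2) (b v.1 v.2) (c v.1 v.2) := by
    have hr : Set.range γ = Set.range fun v : ZMod p × ZMod p =>
        uni h2 (a v.1 v.2) (b v.1 v.2) (c v.1 v.2) := by
      ext φ
      constructor
      · rintro ⟨g, rfl⟩
        exact ⟨(g.x, g.y), (hu g).symm⟩
      · rintro ⟨v, rfl⟩
        exact ⟨⟨v.1, v.2, 0⟩, hu _⟩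
    have hV : p ^ 2 = (Set.univ : Set (ZMod p × ZMod p)).ncard := by
      rw [Set.ncard_univ, Nat.card_prod, Nat.card_zmod, sq]
    rw [hr, ← Set.image_univ, hV] at hcard
    exact Set.injOn_univ.1 (Set.injOn_of_ncard_image_eq hcard)
  have hlin (x y) : a x y = a 1 0 * x := by
    have h1 : uni h2 (a (x + 1) (y + (0 + a x y * 1))) (b (x + 1) (y + (0 + a x y * 1)))
          (c (x + 1) (y + (0 + a x y * 1))) =
        uni h2 (a (1 + x) (0 + (y + a 1 0 * x))) (b (1 + x) (0 + (y + a 1 0 * x)))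
          (c (1 + x) (0 + (y + a 1 0 * x))) := by
      rw [uni_inj, hA, hB, hC, hA, hB, hC]
      refine ⟨add_comm _ _, ?_, add_comm _ _⟩
      linear_combination hcomm' x y 1 0
    have h2 := congrArg Prod.snd (@hinj (_, _) (_, _) h1)
    simp only at h2
    linear_combination h2
  generalize a 1 0 = t at hlin
  simp only [hlin] at hu hA hB hC hcomm' hinj
  have hCy (x y) : c x y = c x 0 + c 0 y := by simpa using hC x 0 0 y
  have hCy1 (y) : c 0 y = c 0 1 * y :=
    ZMod.eq_mul_of_map_add (f := fun y => c 0 y) (fun y y' => by simpa using hC 0 y 0 y') y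
  have htk : t * c 0 1 = 0 := by simpa [mul_comm] using hcomm' 0 1 1 0
  have hCx1 (x) : c x 0 = c 1 0 * x :=
    ZMod.eq_mul_of_map_add (f := fun x => c x 0) (fun x x' => by
      have := hC x 0 x' 0
      rw [hCy, hCy1] at this
      linear_combination this - x * x' * htk) x
  have hBy (x y) : b x y = b x 0 + b 0 y := by simpa using hB x 0 0 y
  have hBy1 (y) : b 0 y = b 0 1 * y :=
    ZMod.eq_mul_of_map_add (f := fun y => b 0 y) (fun y y' => by simpa using hB 0 y 0 y') y
  have hBx1 (x) : b x 0 - (c 1 0 - b 0 1) * t * x ^ 2 / 2 =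
      (b 1 0 - (c 1 0 - b 0 1) * t * 1 ^ 2 / 2) * x :=
    ZMod.eq_mul_of_map_add (f := fun x => b x 0 - (c 1 0 - b 0 1) * t * x ^ 2 / 2) (fun x x' => by
      have := hB x 0 x' 0
      rw [hBy, hBy1, hCx1] at this
      field_simp
      linear_combination 2 * this) x
  refine ⟨⟨t, b 1 0 - (c 1 0 - b 0 1) * t * 1 ^ 2 / 2, b 0 1, c 1 0, c 0 1⟩, ?_, ?_⟩
  · by_cases ht : t = 0
    · refine Or.inl ⟨ht, fun h0 => ?_⟩
      simp only [ht, mul_zero, zero_mul, zero_div, sub_zero] at h0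
      have hBx (x) : b x 0 = b 1 0 * x := by simpa [ht] using hBx1 x
      have hk : ∀ v w : ZMod p × ZMod p, b 1 0 * v.1 + b 0 1 * v.2 = b 1 0 * w.1 + b 0 1 * w.2 →
          c 1 0 * v.1 + c 0 1 * v.2 = c 1 0 * w.1 + c 0 1 * w.2 → v = w := by
        intro v w h h'
        apply hinj
        simp only [uni_inj, ht, zero_mul, true_and]
        rw [hBy, hBy w.1, hCy, hCy w.1, hBx, hBx w.1, hBy1, hBy1 w.2, hCx1, hCx1 w.1, hCy1,
          hCy1 w.2]
        exact ⟨h, h'⟩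
      have e1 := hk (c 0 1, -c 1 0) 0 (by simp; linear_combination h0) (by simp; ring)
      have e2 := hk (b 0 1, -b 1 0) 0 (by simp; ring) (by simp; linear_combination -h0)
      simp only [Prod.mk_eq_zero, neg_eq_zero] at e1 e2
      have e3 := hk (1, 0) 0 (by simp [e2]) (by simp [e1])
      simp at e3
    · have hk : c 0 1 = 0 := (mul_eq_zero.1 htk).resolve_left ht
      refine Or.inr ⟨ht, hk, fun hd => ?_⟩
      simp only at hd
      have : ((0 : ZMod p), (1 : ZMod p)) = (0, 0) := by
        apply hinj
        simp only [uni_inj]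
        rw [hBy1 1, hBy1 0, hCy1 1, hCy1 0, hd, hk]
        simp
      simp at this
  · funext g
    rw [hu, fam, uni_inj]
    refine ⟨rfl, ?_, ?_⟩
    · linear_combination hBy g.x g.y + hBy1 g.y + hBx1 g.x
    · linear_combination hCy g.x g.y + hCy1 g.y + hCx1 g.x

end Heisenberg

/-- The automorphism `α` transports one automorphism-valued function to another. -/
def Transports {M : Type*} [Group M] (α : MulAut M) (γ γ' : M → MulAut M) : Prop :=
  ∀ g h, γ' (α g) (α h) = α (γ g h)

namespace Transports

variable {M : Type*} [Group M] {α β : MulAut M} {γ γ' γ'' : M → MulAut M}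

theorem one : Transports 1 γ γ := fun _ _ => rfl

theorem inv (h : Transports α γ γ') : Transports α⁻¹ γ' γ := by
  intro g k
  apply α.injective
  rw [← h]
  simp

theorem mul (h' : Transports β γ' γ'') (h : Transports α γ γ') :
    Transports (β * α) γ γ'' := by
  intro g k
  rw [MulAut.mul_apply, MulAut.mul_apply, h', h]
  rfl

theorem eq_conj (h : Transports α γ γ') (g : M) : γ' (α g) = α * γ g * α⁻¹ := by
  ext k
  have := h g (α⁻¹ k)
  rwa [MulAut.apply_inv_self] at this

theorem isGamma (h : Transports α γ γ') (hγ : IsGamma γ) : IsGamma γ' := by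
  intro g k
  obtain ⟨g, rfl⟩ := α.surjective g
  obtain ⟨k, rfl⟩ := α.surjective k
  rw [h, ← map_mul, h.eq_conj, hγ, h.eq_conj, h.eq_conj]
  group

theorem card_range (h : Transports α γ γ') :
    Nat.card (Set.range γ') = Nat.card (Set.range γ) := by
  have : Set.range γ' = MulAut.conj α '' Set.range γ := by
    rw [← Set.range_comp, ← α.surjective.range_comp γ']
    congr 1
    funext g
    simp [h.eq_conj]
  rw [this]
  exact Nat.card_image_of_injective (MulAut.conj α).injective _

theorem exists_target (α : MulAut M) (γ : M → MulAut M) : ∃ γ', Transports α γ γ' :=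
  ⟨fun g => α * γ (α⁻¹ g) * α⁻¹, fun g h => by simp⟩

end Transports

namespace Heisenberg

variable {p : ℕ} [Fact p.Prime]

theorem apply_congr (h2 : (2 : ZMod p) ≠ 0) (φ : MulAut (Heisenberg p)) {g h : Heisenberg p}
    (hx : g.x = h.x) (hy : g.y = h.y) : (φ g).x = (φ h).x ∧ (φ g).y = (φ h).y := by
  obtain ⟨m, n, r, s, f, k, hd, rfl⟩ := exists_eq_auto h2 φ
  simp [auto_apply, hx, hy]

/-- The action of automorphisms on the abelianization. -/
@[reducible]
def abAction (h2 : (2 : ZMod p) ≠ 0) : MulAction (MulAut (Heisenberg p)) (ZMod p × ZMod p) where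
  smul φ v := ((φ ⟨v.1, v.2, 0⟩).x, (φ ⟨v.1, v.2, 0⟩).y)
  one_smul _ := rfl
  mul_smul φ ψ v :=
    have h := apply_congr h2 φ (g := ψ ⟨v.1, v.2, 0⟩)
      (h := ⟨(ψ ⟨v.1, v.2, 0⟩).x, (ψ ⟨v.1, v.2, 0⟩).y, 0⟩) rfl rfl
    Prod.ext h.1 h.2

theorem exists_fixed_vector (h2 : (2 : ZMod p) ≠ 0) {γ : Heisenberg p → MulAut (Heisenberg p)}
    (hγ : IsGamma γ) (hcard : Nat.card (Set.range γ) = p ^ 2) :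
    ∃ v : Heisenberg p, (v.x ≠ 0 ∨ v.y ≠ 0) ∧ ∀ g, (γ g v).x = v.x ∧ (γ g v).y = v.y := by
  let := abAction h2
  have hp : IsPGroup p hγ.image := IsPGroup.of_card (n := 2) hcard
  have h0 : (0 : ZMod p × ZMod p) ∈ MulAction.fixedPoints hγ.image (ZMod p × ZMod p) := by
    intro φ
    have : φ.1 (⟨0, 0, 0⟩ : Heisenberg p) = ⟨0, 0, 0⟩ := map_one φ.1
    exact Prod.ext (congrArg Heisenberg.x this) (congrArg Heisenberg.y this)
  obtain ⟨v, hv, hne⟩ := hp.exists_fixed_point_of_prime_dvd_card_of_fixed_point _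
    (by rw [Nat.card_prod, Nat.card_zmod]; exact dvd_mul_right p p) h0
  refine ⟨⟨v.1, v.2, 0⟩, ?_, fun g => ?_⟩
  · by_contra! h
    exact hne (Prod.ext h.1.symm h.2.symm)
  · have := hv ⟨γ g, g, rfl⟩
    exact ⟨congrArg Prod.fst this, congrArg Prod.snd this⟩

theorem exists_transports_uni (h2 : (2 : ZMod p) ≠ 0) {γ : Heisenberg p → MulAut (Heisenberg p)}
    (hγ : IsGamma γ) (hcard : Nat.card (Set.range γ) = p ^ 2) :
    ∃ α γ', Transports α γ γ' ∧ ∀ g, ∃ a b c, γ' g = uni h2 a b c := by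
  obtain ⟨v, hv, hfix⟩ := exists_fixed_vector h2 hγ hcard
  obtain ⟨β, hβ⟩ : ∃ β : MulAut (Heisenberg p), (β τ).x = v.x ∧ (β τ).y = v.y := by
    by_cases hy : v.y = 0
    · exact ⟨auto h2 0 v.x 1 v.y 0 0 (by simpa [hy] using hv), by simp [auto_apply, τ]⟩
    · exact ⟨auto h2 1 v.x 0 v.y 0 0 (by simpa using hy), by simp [auto_apply, τ]⟩
  obtain ⟨γ', hγ'⟩ := Transports.exists_target β⁻¹ γ
  refine ⟨_, γ', hγ', fun g => ?_⟩
  have hpow : γ' g ^ p ^ 2 = 1 := by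
    have h := pow_card_eq_one' (x := (⟨γ' g, g, rfl⟩ : (hγ'.isGamma hγ).image))
    have hc : Nat.card (hγ'.isGamma hγ).image = p ^ 2 := hγ'.card_range.trans hcard
    rw [hc] at h
    exact congrArg Subtype.val h
  have hτ : (γ' g τ).x = 0 ∧ (γ' g τ).y = 1 := by
    have h := hγ'.inv g τ
    rw [inv_inv] at h
    have hw := hfix (β g)
    have hw' := apply_congr h2 (γ (β g)) hβ.1 hβ.2
    have hx := congrArg Heisenberg.x h
    have hy := congrArg Heisenberg.y h
    rw [hw'.1, hw.1, ← hβ.1] at hx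
    rw [hw'.2, hw.2, ← hβ.2] at hy
    obtain ⟨m, n, r, s, f, k, hd, rfl⟩ := exists_eq_auto h2 β
    simp only [auto_apply, τ, mul_zero, mul_one, zero_add] at hx hy
    set u := γ' g ⟨0, 1, 0⟩
    change u.x = 0 ∧ u.y = 1
    constructor
    · refine (mul_eq_zero.1 (show (m * s - n * r) * u.x = 0 from ?_)).resolve_left hd
      linear_combination n * hy - s * hx
    · refine sub_eq_zero.1 ((mul_eq_zero.1
        (show (m * s - n * r) * (u.y - 1) = 0 from ?_)).resolve_left hd)
      linear_combination r * hx - m * hy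
  obtain ⟨m, n, r, s, f, k, hd, hγg⟩ := exists_eq_auto h2 (γ' g)
  rw [hγg] at hτ hpow
  simp only [auto_apply, τ, mul_zero, mul_one, zero_add] at hτ
  obtain ⟨rfl, rfl⟩ := hτ
  have hx (N : ℕ) (w : Heisenberg p) : ((auto h2 m 0 r 1 f k hd ^ N) w).x = m ^ N * w.x := by
    induction N with
    | zero => simp
    | succ N ih =>
      rw [pow_succ', MulAut.mul_apply, auto_apply]
      simp only [ih, zero_mul, add_zero]
      ring
  have hm : m = 1 := by
    have h := hx (p ^ 2) σ
    rw [hpow, sq, pow_mul, ZMod.pow_card, ZMod.pow_card] at h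
    simpa [σ] using h.symm
  subst hm
  refine ⟨r, f, k, ?_⟩
  rw [hγg]
  ext w <;> simp [auto_apply, uni_apply] <;> ring

/-- Normal forms for the gamma functions with image of order `p ^ 2`. -/
abbrev NormalForm (p : ℕ) : Type :=
  (ZMod p × (ZMod p)ˣ) ⊕ (ZMod p)ˣ ⊕ (ZMod p × (ZMod p)ˣ)

/-- The parameters of a normal form. -/
def NormalForm.params : NormalForm p → Params p
  | .inl (c, D) => ⟨0, 1, 0, c, D⟩
  | .inr (.inl c) => ⟨0, 0, -(c / 2), c / 2, 0⟩
  | .inr (.inr (c, δ)) => ⟨1, 0, δ, c + δ, 0⟩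

/-- The value of `e - d` at the parameters of a normal form. -/
def NormalForm.twist : NormalForm p → ZMod p
  | .inl (c, _) => c
  | .inr (.inl c) => c
  | .inr (.inr (c, _)) => c

theorem NormalForm.good (h2 : (2 : ZMod p) ≠ 0) (t : NormalForm p) : t.params.Good := by
  rcases t with ⟨c, D⟩ | c | ⟨c, δ⟩
  · exact Or.inl ⟨rfl, by simp [params]⟩
  · exact Or.inl ⟨rfl, by simp [params, h2]⟩
  · exact Or.inr ⟨one_ne_zero, rfl, δ.ne_zero⟩

theorem NormalForm.sub_eq_twist (h2 : (2 : ZMod p) ≠ 0) (t : NormalForm p) :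
    t.params.e - t.params.d = t.twist := by
  rcases t with ⟨c, D⟩ | c | ⟨c, δ⟩
  · simp [params, twist]
  · have : NeZero (2 : ZMod p) := ⟨h2⟩
    simp [params, twist]
  · simp [params, twist]

theorem transports_form (h2 : (2 : ZMod p) ≠ 0) {b d e k m r : ZMod p}
    (hq : b * m ^ 2 + (d + e) * m * r + k * r ^ 2 ≠ 0) :
    ∃ α, Transports α (fam h2 ⟨0, b, d, e, k⟩) (fam h2 ⟨0, 1, 0, e - d, b * k - d * e⟩) := by
  have hd : m * (b * m + e * r) - -(d * m + k * r) * r ≠ 0 := by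
    convert hq using 1
    ring
  refine ⟨(auto h2 m (-(d * m + k * r)) r (b * m + e * r) 0 0 hd)⁻¹, Transports.inv ?_⟩
  intro g h
  simp only [fam, uni_apply, auto_apply]
  ext
  · simp
  · simp
  · simp
    ring

theorem exists_normalForm (h2 : (2 : ZMod p) ≠ 0) {P : Params p} (hP : P.Good) :
    ∃ (t : NormalForm p) (α : MulAut (Heisenberg p)),
      Transports α (fam h2 P) (fam h2 t.params) := by
  obtain ⟨a, b, d, e, k⟩ := P
  rcases hP with ⟨ha, hD⟩ | ⟨ha, hk, hd⟩
  · obtain rfl : a = 0 := ha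
    simp only at hD
    by_cases hq : ∃ m r, b * m ^ 2 + (d + e) * m * r + k * r ^ 2 ≠ 0
    · obtain ⟨m, r, hq⟩ := hq
      exact ⟨.inl (e - d, Units.mk0 _ hD), transports_form h2 hq⟩
    · push Not at hq
      obtain rfl : b = 0 := by simpa using hq 1 0
      obtain rfl : k = 0 := by simpa using hq 0 1
      obtain rfl : d = -e := by linear_combination hq 1 1
      have he : e ≠ 0 := by
        rintro rfl
        simp at hD
      refine ⟨.inr (.inl (Units.mk0 (2 * e) (mul_ne_zero h2 he))), 1, ?_⟩
      have : (⟨0, 0, -e, e, 0⟩ : Params p) =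
          NormalForm.params (.inr (.inl (Units.mk0 (2 * e) (mul_ne_zero h2 he)))) := by
        simp [NormalForm.params, h2]
      rw [this]
      exact Transports.one
  · obtain rfl : k = 0 := hk
    simp only at ha hd
    refine ⟨.inr (.inr (e - d, Units.mk0 d hd)), auto h2 a 0 0 a 0 (-(a * b))
      (by simpa using ha), ?_⟩
    intro g h
    simp only [fam, uni_apply, auto_apply, NormalForm.params]
    ext
    · simp
    · simp
      ring
    · simp
      ring

theorem Transports.a_ne_zero (h2 : (2 : ZMod p) ≠ 0) {P P' : Params p}
    {α : MulAut (Heisenberg p)} (h : Transports α (fam h2 P) (fam h2 P')) (ha : P.a ≠ 0) :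
    P'.a ≠ 0 := by
  intro ha'
  obtain ⟨m, n, r, s, f, k, hd, rfl⟩ := exists_eq_auto h2 α
  have hx := congrArg Heisenberg.x (h σ σ)
  have hy := congrArg Heisenberg.y (h σ σ)
  simp [fam, uni_apply, auto_apply, σ, ha, ha'] at hx hy
  simp [hx, hy] at hd

theorem Transports.eq_of_a_ne_zero (h2 : (2 : ZMod p) ≠ 0) {P P' : Params p}
    {α : MulAut (Heisenberg p)} (h : Transports α (fam h2 P) (fam h2 P')) (ha : P.a ≠ 0)
    (hk : P'.k = 0) : P'.d = P.d ∧ P'.e = P.e := by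
  obtain ⟨m, n, r, s, f, k, hd, rfl⟩ := exists_eq_auto h2 α
  have hx := congrArg Heisenberg.x (h σ σ)
  have h₁ := congrArg Heisenberg.z (h τ σ)
  have h₃ := congrArg Heisenberg.z (h σ τ)
  simp [fam, uni_apply, auto_apply, σ, ha] at hx
  subst hx
  simp [fam, uni_apply, auto_apply, σ, τ] at h₁ h₃ hd
  have hms : m * s ≠ 0 := mul_ne_zero hd.1 hd.2
  constructor
  · apply mul_left_cancel₀ hms
    linear_combination h₁ - s * r * hk
  · apply mul_left_cancel₀ hms
    linear_combination h₃ - r * s * hk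

theorem Transports.form_eq (h2 : (2 : ZMod p) ≠ 0) {b d e k b' d' e' k' : ZMod p}
    {α : MulAut (Heisenberg p)}
    (h : Transports α (fam h2 ⟨0, b, d, e, k⟩) (fam h2 ⟨0, b', d', e', k'⟩)) :
    ∃ m n r s : ZMod p, m * s - n * r ≠ 0 ∧
      b' * m * m + d' * r * m + e' * m * r + k' * r * r = (m * s - n * r) * b ∧
      b' * m * n + d' * r * n + e' * m * s + k' * r * s = (m * s - n * r) * e ∧
      b' * n * m + d' * s * m + e' * n * r + k' * s * r = (m * s - n * r) * d ∧
      b' * n * n + d' * s * n + e' * n * s + k' * s * s = (m * s - n * r) * k := by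
  obtain ⟨m, n, r, s, f, k, hd, rfl⟩ := exists_eq_auto h2 α
  have h₁ := congrArg Heisenberg.z (h σ σ)
  have h₃ := congrArg Heisenberg.z (h σ τ)
  have h₄ := congrArg Heisenberg.z (h τ σ)
  have h₅ := congrArg Heisenberg.z (h τ τ)
  simp [fam, uni_apply, auto_apply, σ, τ] at h₁ h₃ h₄ h₅
  refine ⟨m, n, r, s, hd, ?_, ?_, ?_, ?_⟩
  · linear_combination h₁
  · linear_combination h₃
  · linear_combination h₄
  · linear_combination h₅

theorem Transports.twist_eq (h2 : (2 : ZMod p) ≠ 0) {b d e k b' d' e' k' : ZMod p}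
    {α : MulAut (Heisenberg p)}
    (h : Transports α (fam h2 ⟨0, b, d, e, k⟩) (fam h2 ⟨0, b', d', e', k'⟩)) :
    e' - d' = e - d := by
  obtain ⟨m, n, r, s, hd, -, h₁, h₃, -⟩ := form_eq h2 h
  apply mul_left_cancel₀ hd
  linear_combination h₁ - h₃

theorem Transports.det_eq (h2 : (2 : ZMod p) ≠ 0) {b d e k b' d' e' k' : ZMod p}
    {α : MulAut (Heisenberg p)}
    (h : Transports α (fam h2 ⟨0, b, d, e, k⟩) (fam h2 ⟨0, b', d', e', k'⟩)) :
    b' * k' - d' * e' = b * k - d * e := by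
  obtain ⟨m, n, r, s, hd, h₁, h₃, h₄, h₅⟩ := form_eq h2 h
  apply mul_left_cancel₀ (mul_ne_zero hd hd)
  calc _ = (b' * m * m + d' * r * m + e' * m * r + k' * r * r) *
        (b' * n * n + d' * s * n + e' * n * s + k' * s * s) -
        (b' * m * n + d' * r * n + e' * m * s + k' * r * s) *
        (b' * n * m + d' * s * m + e' * n * r + k' * s * r) := by ring
    _ = _ := by rw [h₁, h₃, h₄, h₅]; ring

theorem not_transports_alternating (h2 : (2 : ZMod p) ≠ 0) {d e k e' : ZMod p}
    {α : MulAut (Heisenberg p)} :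
    ¬ Transports α (fam h2 ⟨0, 1, d, e, k⟩) (fam h2 ⟨0, 0, -e', e', 0⟩) := by
  intro h
  obtain ⟨m, n, r, s, hd, h₁, -⟩ := Transports.form_eq h2 h
  exact hd (by linear_combination -h₁)

theorem normalForm_unique (h2 : (2 : ZMod p) ≠ 0) {t t' : NormalForm p}
    {α : MulAut (Heisenberg p)} (h : Transports α (fam h2 t.params) (fam h2 t'.params)) :
    t = t' := by
  rcases t with ⟨c, D⟩ | c | ⟨c, δ⟩ <;> rcases t' with ⟨c', D'⟩ | c' | ⟨c', δ'⟩
  · have hc := Transports.twist_eq h2 h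
    have hD := Transports.det_eq h2 h
    simp only [sub_zero, one_mul, zero_mul] at hc hD
    rw [hc, Units.ext hD]
  · exact (not_transports_alternating h2 h).elim
  · exact (Transports.a_ne_zero h2 h.inv one_ne_zero rfl).elim
  · exact (not_transports_alternating h2 h.inv).elim
  · have : NeZero (2 : ZMod p) := ⟨h2⟩
    have hc := Transports.twist_eq h2 h
    rw [sub_neg_eq_add, sub_neg_eq_add, add_halves, add_halves] at hc
    rw [Units.ext hc]
  · exact (Transports.a_ne_zero h2 h.inv one_ne_zero rfl).elim
  · exact (Transports.a_ne_zero h2 h one_ne_zero rfl).elim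
  · exact (Transports.a_ne_zero h2 h one_ne_zero rfl).elim
  · obtain ⟨hd, he⟩ := Transports.eq_of_a_ne_zero h2 h one_ne_zero rfl
    obtain rfl := Units.ext hd
    rw [add_right_cancel he]

end Heisenberg

section Regular

variable {M : Type*} [Group M] {γ γ' : M → MulAut M}

/-- The permutation of `M` composed of the automorphism `γ g` and left translation by `g`. -/
def gammaPerm (γ : M → MulAut M) (g : M) : Equiv.Perm M :=
  Equiv.mulLeft g * MulAut.toPerm M (γ g)

theorem MulAut.toPerm_apply_apply (φ : MulAut M) (g : M) : MulAut.toPerm M φ g = φ g := rfl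

theorem gammaPerm_apply (γ : M → MulAut M) (g h : M) : gammaPerm γ g h = g * γ g h := rfl

theorem gammaPerm_one (γ : M → MulAut M) (g : M) : gammaPerm γ g 1 = g := by
  rw [gammaPerm_apply, map_one, mul_one]

theorem gammaPerm_injective (γ : M → MulAut M) : Function.Injective (gammaPerm γ) := by
  intro g h hgh
  rw [← gammaPerm_one γ g, hgh, gammaPerm_one]

namespace IsGamma

theorem gammaPerm_mul (hγ : IsGamma γ) (g h : M) :
    gammaPerm γ g * gammaPerm γ h = gammaPerm γ (g * γ g h) := by
  ext k
  rw [Equiv.Perm.mul_apply, gammaPerm_apply, gammaPerm_apply, gammaPerm_apply, hγ, map_mul,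
    mul_assoc, MulAut.mul_apply]

/-- The regular subgroup determined by a gamma function. -/
def toSubgroup (hγ : IsGamma γ) : Subgroup (Equiv.Perm M) where
  carrier := Set.range (gammaPerm γ)
  one_mem' := ⟨1, by ext k; simp [gammaPerm_apply, hγ.map_one]⟩
  mul_mem' := by
    rintro _ _ ⟨g, rfl⟩ ⟨h, rfl⟩
    exact ⟨_, (hγ.gammaPerm_mul g h).symm⟩
  inv_mem' := by
    rintro _ ⟨g, rfl⟩
    refine ⟨(γ g).symm g⁻¹, eq_inv_of_mul_eq_one_right ?_⟩
    rw [hγ.gammaPerm_mul, MulEquiv.apply_symm_apply, mul_inv_cancel]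
    ext k
    simp [gammaPerm_apply, hγ.map_one]

theorem gammaPerm_mem (hγ : IsGamma γ) (g : M) : gammaPerm γ g ∈ hγ.toSubgroup := ⟨g, rfl⟩

theorem isRegularSub_toSubgroup (hγ : IsGamma γ) : IsRegularSub hγ.toSubgroup := by
  intro x y
  refine ⟨gammaPerm γ y * (gammaPerm γ x)⁻¹,
    ⟨mul_mem (hγ.gammaPerm_mem y) (inv_mem (hγ.gammaPerm_mem x)), ?_⟩, ?_⟩
  · have : (gammaPerm γ x)⁻¹ x = 1 := by
      rw [Equiv.Perm.inv_eq_iff_eq, gammaPerm_one]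
    rw [Equiv.Perm.mul_apply, this, gammaPerm_one]
  · rintro π ⟨hπ, hxy⟩
    obtain ⟨g, hg⟩ := mul_mem hπ (hγ.gammaPerm_mem x)
    have h1 := gammaPerm_one γ g
    rw [hg, Equiv.Perm.mul_apply, gammaPerm_one, hxy] at h1
    rw [eq_mul_inv_iff_mul_eq, ← hg, h1]

/-- A bijection turning the operation `g * γ g h` into multiplication identifies the regular
subgroup of `γ`. -/
theorem nonempty_mulEquiv (hγ : IsGamma γ) {K : Type*} [Group K] (F : M ≃ K)
    (hF : ∀ g h, F (g * γ g h) = F g * F h) : Nonempty (hγ.toSubgroup ≃* K) := by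
  let e : M ≃ hγ.toSubgroup := Equiv.ofInjective _ (gammaPerm_injective γ)
  have he (g h : M) : e (g * γ g h) = e g * e h := Subtype.ext (hγ.gammaPerm_mul g h).symm
  refine ⟨MulEquiv.mk' (e.symm.trans F) fun a b => ?_⟩
  obtain ⟨g, rfl⟩ := e.surjective a
  obtain ⟨h, rfl⟩ := e.surjective b
  rw [← he]
  simp [hF]

theorem map_conj_eq_iff (hγ : IsGamma γ) (hγ' : IsGamma γ') (α : MulAut M) :
    hγ.toSubgroup.map (MulAut.conj (MulAut.toPerm M α)).toMonoidHom = hγ'.toSubgroup ↔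
      Transports α γ γ' := by
  have happly (g h : M) :
      MulAut.conj (MulAut.toPerm M α) (gammaPerm γ g) (α h) = α g * α (γ g h) := by
    have : (MulAut.toPerm M α)⁻¹ (α h) = h := by
      rw [Equiv.Perm.inv_eq_iff_eq]
      rfl
    rw [MulAut.conj_apply, Equiv.Perm.mul_apply, Equiv.Perm.mul_apply, this, gammaPerm_apply,
      ← map_mul]
    rfl
  constructor
  · intro heq g h
    obtain ⟨g', hg'⟩ : MulAut.conj (MulAut.toPerm M α) (gammaPerm γ g) ∈ hγ'.toSubgroup :=
      heq ▸ Subgroup.mem_map_of_mem _ (hγ.gammaPerm_mem g)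
    have h1 := happly g 1
    rw [← hg', _root_.map_one α, _root_.map_one (γ g), _root_.map_one α, mul_one,
      gammaPerm_one] at h1
    have h2 := happly g h
    rw [← hg', h1, gammaPerm_apply] at h2
    exact mul_left_cancel h2
  · intro ht
    have hconj (g : M) :
        MulAut.conj (MulAut.toPerm M α) (gammaPerm γ g) = gammaPerm γ' (α g) := by
      ext k
      obtain ⟨k, rfl⟩ := α.surjective k
      rw [happly, gammaPerm_apply, ht]
    ext π
    constructor
    · rintro ⟨_, ⟨g, rfl⟩, rfl⟩
      exact ⟨α g, (hconj g).symm⟩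
    · rintro ⟨g, rfl⟩
      obtain ⟨g, rfl⟩ := α.surjective g
      exact ⟨_, hγ.gammaPerm_mem g, hconj g⟩

end IsGamma

end Regular

theorem Nat.card_quot_of_representatives {X T : Type*} {r : X → X → Prop} (hr : Equivalence r)
    (rep : T → X) (hs : ∀ x, ∃ t, r x (rep t)) (hu : ∀ t t', r (rep t) (rep t') → t = t') :
    Nat.card (Quot r) = Nat.card T := by
  refine (Nat.card_eq_of_bijective (fun t => Quot.mk r (rep t))
    ⟨fun t t' h => ?_, fun q => ?_⟩).symm
  · exact hu t t' (hr.eqvGen_iff.1 (Quot.eqvGen_exact h))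
  · induction q using Quot.ind with
    | mk x =>
      obtain ⟨t, ht⟩ := hs x
      exact ⟨t, (Quot.sound ht).symm⟩

namespace Heisenberg

variable {p : ℕ}

theorem exists_eq_of_mem_Hol {π : Equiv.Perm (Heisenberg p)} (hπ : π ∈ Hol p) :
    ∃ g φ, π = Equiv.mulLeft g * MulAut.toPerm (Heisenberg p) φ := by
  refine Subgroup.closure_induction (k := ((leftMulHom p).range : Set _) ∪
    ((MulAut.toPerm (Heisenberg p)).range : Set _)) (p := fun π _ => ∃ g φ,
      π = Equiv.mulLeft g * MulAut.toPerm (Heisenberg p) φ) ?_ ?_ ?_ ?_ (x := π) ?_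
  · rintro _ (⟨g, rfl⟩ | ⟨φ, rfl⟩)
    · exact ⟨g, 1, by ext1 k; simp [leftMulHom]⟩
    · exact ⟨1, φ, by ext1 k; simp⟩
  · exact ⟨1, 1, by ext1 k; simp⟩
  · rintro _ _ - - ⟨g, φ, rfl⟩ ⟨h, ψ, rfl⟩
    exact ⟨g * φ h, φ * ψ, by ext1 k; simp [mul_assoc, MulAut.toPerm_apply_apply]⟩
  · rintro _ - ⟨g, φ, rfl⟩
    refine ⟨φ⁻¹ g⁻¹, φ⁻¹, ?_⟩
    rw [inv_eq_iff_mul_eq_one]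
    ext1 k
    simp only [Equiv.Perm.mul_apply, Equiv.coe_mulLeft, MulAut.toPerm_apply_apply, map_mul,
      MulAut.apply_inv_self, mul_inv_cancel_left, Equiv.Perm.one_apply]
  · rwa [Hol, Subgroup.sup_eq_closure] at hπ

theorem gammaPerm_mem_Hol (γ : Heisenberg p → MulAut (Heisenberg p)) (g : Heisenberg p) :
    gammaPerm γ g ∈ Hol p :=
  mul_mem (Subgroup.mem_sup_left ⟨g, Equiv.ext fun _ => rfl⟩) (Subgroup.mem_sup_right ⟨γ g, rfl⟩)

theorem toSubgroup_le_Hol {γ : Heisenberg p → MulAut (Heisenberg p)} (hγ : IsGamma γ) :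
    hγ.toSubgroup ≤ Hol p := by
  rintro _ ⟨g, rfl⟩
  exact gammaPerm_mem_Hol γ g

theorem thetaCard_toSubgroup {γ : Heisenberg p → MulAut (Heisenberg p)} (hγ : IsGamma γ) :
    thetaCard p hγ.toSubgroup = Nat.card (Set.range γ) := by
  have hθ (g : Heisenberg p) :
      theta p (gammaPerm γ g) = MulAut.toPerm (Heisenberg p) (γ g) := by
    rw [theta, gammaPerm_one, gammaPerm, inv_mul_cancel_left]
  have himg : theta p '' (hγ.toSubgroup : Set (Equiv.Perm (Heisenberg p))) =
      MulAut.toPerm (Heisenberg p) '' Set.range γ := by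
    change theta p '' Set.range (gammaPerm γ) = _
    rw [← Set.range_comp, ← Set.range_comp]
    exact congrArg Set.range (funext hθ)
  rw [thetaCard, himg]
  exact Nat.card_image_of_injective
    (fun φ ψ h => MulEquiv.ext fun k => Equiv.congr_fun h k) _

theorem exists_isGamma {G : Subgroup (Equiv.Perm (Heisenberg p))} (hle : G ≤ Hol p)
    (hreg : IsRegularSub G) :
    ∃ (γ : Heisenberg p → MulAut (Heisenberg p)) (hγ : IsGamma γ), G = hγ.toSubgroup := by
  have hex (g : Heisenberg p) :
      ∃ φ : MulAut (Heisenberg p), Equiv.mulLeft g * MulAut.toPerm (Heisenberg p) φ ∈ G := by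
    obtain ⟨π, ⟨hπ, hπg⟩, -⟩ := hreg 1 g
    obtain ⟨g', φ, rfl⟩ := exists_eq_of_mem_Hol (hle hπ)
    obtain rfl : g' = g := by simpa [MulAut.toPerm_apply_apply] using hπg
    exact ⟨φ, hπ⟩
  choose γ hmem using hex
  have huniq {π : Equiv.Perm (Heisenberg p)} (hπ : π ∈ G) : gammaPerm γ (π 1) = π :=
    (hreg 1 (π 1)).unique ⟨hmem _, gammaPerm_one _ _⟩ ⟨hπ, rfl⟩
  have hγ : IsGamma γ := by
    intro g h
    have heq := huniq (mul_mem (hmem g) (hmem h))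
    ext1 k
    have hk := Equiv.congr_fun heq k
    simpa [gammaPerm_apply, mul_assoc, MulAut.toPerm_apply_apply] using hk
  refine ⟨γ, hγ, le_antisymm (fun π hπ => ⟨_, huniq hπ⟩) ?_⟩
  rintro _ ⟨g, rfl⟩
  exact hmem g

theorem autConj_one (G : Subgroup (Equiv.Perm (Heisenberg p))) : autConj p 1 G = G := by
  rw [autConj, map_one, map_one]
  exact Subgroup.map_id G

theorem autConj_mul (α β : MulAut (Heisenberg p)) (G : Subgroup (Equiv.Perm (Heisenberg p))) :
    autConj p (α * β) G = autConj p α (autConj p β G) := by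
  rw [autConj, autConj, autConj, Subgroup.map_map, map_mul, map_mul]
  rfl

theorem equivalence_autConj (C : Subgroup (Equiv.Perm (Heisenberg p)) → Prop) :
    Equivalence fun G G' : {G // C G} => ∃ α : MulAut (Heisenberg p),
      autConj p α G.1 = G'.1 where
  refl G := ⟨1, autConj_one G.1⟩
  symm := by
    rintro G G' ⟨α, h⟩
    exact ⟨α⁻¹, by rw [← h, ← autConj_mul, inv_mul_cancel, autConj_one]⟩
  trans := by
    rintro G G' G'' ⟨α, h⟩ ⟨β, h'⟩
    exact ⟨β * α, by rw [autConj_mul, h, h']⟩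

section Prime

variable [Fact p.Prime]

/-- The regular subgroup attached to a normal form. -/
def NormalForm.toSubgroup (h2 : (2 : ZMod p) ≠ 0) (t : NormalForm p) :
    Subgroup (Equiv.Perm (Heisenberg p)) :=
  (isGamma_fam h2 (t.good h2)).toSubgroup

theorem exists_autConj_eq (h2 : (2 : ZMod p) ≠ 0) {G : Subgroup (Equiv.Perm (Heisenberg p))}
    (hle : G ≤ Hol p) (hreg : IsRegularSub G) (hcard : thetaCard p G = p ^ 2) :
    ∃ (t : NormalForm p) (α : MulAut (Heisenberg p)), autConj p α G = t.toSubgroup h2 := by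
  obtain ⟨γ, hγ, rfl⟩ := exists_isGamma hle hreg
  rw [thetaCard_toSubgroup] at hcard
  obtain ⟨α, γ', hα, hu⟩ := exists_transports_uni h2 hγ hcard
  obtain ⟨P, hP, rfl⟩ := exists_eq_fam h2 (hα.isGamma hγ) (hα.card_range.trans hcard) hu
  obtain ⟨t, β, hβ⟩ := exists_normalForm h2 hP
  exact ⟨t, β * α, (hγ.map_conj_eq_iff _ _).2 (hβ.mul hα)⟩

theorem card_orbits (h2 : (2 : ZMod p) ≠ 0) (K : Type*) [Group K] :
    Nat.card (Quot (fun (G G' : {G : Subgroup (Equiv.Perm (Heisenberg p)) //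
        G ≤ Hol p ∧ IsRegularSub G ∧ thetaCard p G = p ^ 2 ∧ Nonempty (G ≃* K)}) =>
      ∃ α : MulAut (Heisenberg p), autConj p α G.1 = G'.1)) =
    Nat.card {t : NormalForm p // Nonempty (t.toSubgroup h2 ≃* K)} := by
  refine Nat.card_quot_of_representatives (equivalence_autConj _)
    (fun t => ⟨t.1.toSubgroup h2, toSubgroup_le_Hol _, IsGamma.isRegularSub_toSubgroup _,
      (thetaCard_toSubgroup _).trans (card_range_fam h2 (t.1.good h2)), t.2⟩) ?_ ?_
  · rintro ⟨G, hle, hreg, hcard, ⟨e⟩⟩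
    obtain ⟨t, α, hα⟩ := exists_autConj_eq h2 hle hreg hcard
    refine ⟨⟨t, ?_⟩, α, hα⟩
    rw [← hα]
    exact ⟨(Subgroup.equivMapOfInjective G _ (MulEquiv.injective _)).symm.trans e⟩
  · rintro t t' ⟨α, hα⟩
    exact Subtype.ext (normalForm_unique h2 ((IsGamma.map_conj_eq_iff (isGamma_fam h2
      (t.1.good h2)) (isGamma_fam h2 (t'.1.good h2)) α).1 hα))

/-- Coordinates linearizing the regular subgroup of `fam h2 P`. -/
def linearCoords (P : Params p) {c : ZMod p} (hc : c ≠ 0) :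
    Heisenberg p ≃ ZMod p × ZMod p × ZMod p where
  toFun g := (g.x, g.y - P.a * g.x ^ 2 / 2, (g.z - (1 + P.e) * P.a * g.x ^ 3 / 6
    - P.b * g.x ^ 2 / 2 - P.k * (g.y - P.a * g.x ^ 2 / 2) ^ 2 / 2
    - P.e * g.x * (g.y - P.a * g.x ^ 2 / 2)) / c)
  invFun v := ⟨v.1, v.2.1 + P.a * v.1 ^ 2 / 2, v.2.2 * c + (1 + P.e) * P.a * v.1 ^ 3 / 6
    + P.b * v.1 ^ 2 / 2 + P.k * v.2.1 ^ 2 / 2 + P.e * v.1 * v.2.1⟩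
  left_inv g := by
    ext
    · simp
    · simp
    · simp [div_mul_cancel₀ _ hc]
      ring
  right_inv v := by
    ext <;> simp
    rw [div_eq_iff hc]
    ring

theorem linearCoords_mul (h2 : (2 : ZMod p) ≠ 0) (h3 : (3 : ZMod p) ≠ 0) {P : Params p}
    (hP : P.Good) {c : ZMod p} (hc : c ≠ 0) (g h : Heisenberg p) :
    linearCoords P hc (g * fam h2 P g h) = ((linearCoords P hc g).1 + (linearCoords P hc h).1,
      (linearCoords P hc g).2.1 + (linearCoords P hc h).2.1,
      (linearCoords P hc g).2.2 + (linearCoords P hc h).2.2 +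
        (1 - (P.e - P.d)) / c * ((linearCoords P hc g).2.1 * (linearCoords P hc h).1)) := by
  have hak := hP.mul_eq_zero
  have h6 : (6 : ZMod p) ≠ 0 := by
    convert mul_ne_zero h2 h3 using 1
    norm_num
  simp only [linearCoords, Equiv.coe_fn_mk, fam, uni_apply, mul_x, mul_y, mul_z]
  refine Prod.ext rfl (Prod.ext ?_ ?_)
  · simp
    field_simp
    ring
  · rcases mul_eq_zero.1 hak with h0 | h0
    · simp only [h0]
      field_simp
      ring
    · simp only [h0]
      field_simp
      ring

end Prime

end Heisenberg

namespace Heisenberg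

variable {p : ℕ} [Fact p.Prime]

theorem isEmpty_mulEquiv_prod :
    IsEmpty (Heisenberg p ≃* Multiplicative (ZMod p × ZMod p × ZMod p)) := by
  refine ⟨fun e => ?_⟩
  have h : (σ * τ : Heisenberg p) = τ * σ := e.injective (by rw [map_mul, map_mul, mul_comm])
  simpa [σ, τ] using congrArg Heisenberg.z h

theorem nonempty_mulEquiv_of_twist_ne_one (h2 : (2 : ZMod p) ≠ 0) (h3 : (3 : ZMod p) ≠ 0)
    {t : NormalForm p} (ht : t.twist ≠ 1) : Nonempty (t.toSubgroup h2 ≃* Heisenberg p) := by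
  have hc : 1 - t.twist ≠ 0 := sub_ne_zero.2 ht.symm
  let F : ZMod p × ZMod p × ZMod p ≃ Heisenberg p :=
    ⟨fun v => ⟨v.1, v.2.1, v.2.2⟩, fun g => (g.x, g.y, g.z), fun _ => rfl, fun _ => rfl⟩
  refine IsGamma.nonempty_mulEquiv _ ((linearCoords t.params hc).trans F) fun g h => ?_
  rw [Equiv.trans_apply, linearCoords_mul h2 h3 (t.good h2), t.sub_eq_twist h2, div_self hc,
    one_mul, mul_comm (Prod.fst (Prod.snd _))]
  rfl

theorem nonempty_mulEquiv_of_twist_eq_one (h2 : (2 : ZMod p) ≠ 0) (h3 : (3 : ZMod p) ≠ 0)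
    {t : NormalForm p} (ht : t.twist = 1) :
    Nonempty (t.toSubgroup h2 ≃* Multiplicative (ZMod p × ZMod p × ZMod p)) := by
  refine IsGamma.nonempty_mulEquiv _
    ((linearCoords t.params (one_ne_zero : (1 : ZMod p) ≠ 0)).trans Multiplicative.ofAdd)
    fun g h => ?_
  rw [Equiv.trans_apply, linearCoords_mul h2 h3 (t.good h2), t.sub_eq_twist h2, ht, sub_self,
    zero_div, zero_mul, add_zero]
  rfl

theorem nonempty_mulEquiv_prod_iff (h2 : (2 : ZMod p) ≠ 0) (h3 : (3 : ZMod p) ≠ 0)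
    (t : NormalForm p) :
    Nonempty (t.toSubgroup h2 ≃* Multiplicative (ZMod p × ZMod p × ZMod p)) ↔ t.twist = 1 := by
  refine ⟨fun ⟨e⟩ => ?_, nonempty_mulEquiv_of_twist_eq_one h2 h3⟩
  by_contra ht
  obtain ⟨e'⟩ := nonempty_mulEquiv_of_twist_ne_one h2 h3 ht
  exact isEmpty_mulEquiv_prod.elim (e'.symm.trans e)

theorem nonempty_mulEquiv_iff (h2 : (2 : ZMod p) ≠ 0) (h3 : (3 : ZMod p) ≠ 0)
    (t : NormalForm p) : Nonempty (t.toSubgroup h2 ≃* Heisenberg p) ↔ ¬ t.twist = 1 := by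
  refine ⟨fun ⟨e⟩ ht => ?_, nonempty_mulEquiv_of_twist_ne_one h2 h3⟩
  obtain ⟨e'⟩ := nonempty_mulEquiv_of_twist_eq_one h2 h3 ht
  exact isEmpty_mulEquiv_prod.elim (e.symm.trans e')

/-- The normal forms of twist one. -/
def twistOneEquiv : {t : NormalForm p // t.twist = 1} ≃ (ZMod p)ˣ ⊕ Unit ⊕ (ZMod p)ˣ where
  toFun
    | ⟨.inl (_, D), _⟩ => .inl D
    | ⟨.inr (.inl _), _⟩ => .inr (.inl ())
    | ⟨.inr (.inr (_, δ)), _⟩ => .inr (.inr δ)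
  invFun
    | .inl D => ⟨.inl (1, D), rfl⟩
    | .inr (.inl _) => ⟨.inr (.inl 1), rfl⟩
    | .inr (.inr δ) => ⟨.inr (.inr (1, δ)), rfl⟩
  left_inv := by
    rintro ⟨⟨c, D⟩ | c | ⟨c, δ⟩, h⟩
    · obtain rfl : c = 1 := h
      rfl
    · obtain rfl : c = 1 := Units.ext h
      rfl
    · obtain rfl : c = 1 := h
      rfl
  right_inv := by
    rintro (D | _ | δ) <;> rfl

theorem card_twist_eq_one : Nat.card {t : NormalForm p // t.twist = 1} = 2 * p - 1 := by
  have hp := (Fact.out : p.Prime).two_le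
  rw [Nat.card_congr twistOneEquiv, Nat.card_sum, Nat.card_sum, Nat.card_eq_fintype_card,
    ZMod.card_units_eq_totient, Nat.totient_prime Fact.out, Nat.card_unique]
  omega

theorem card_twist_ne_one :
    Nat.card {t : NormalForm p // ¬ t.twist = 1} = (2 * p - 3) * p := by
  have htot : Nat.card (NormalForm p) = p * (p - 1) + (p - 1 + p * (p - 1)) := by
    rw [Nat.card_sum, Nat.card_sum, Nat.card_prod, Nat.card_eq_fintype_card (α := (ZMod p)ˣ),
      ZMod.card_units_eq_totient, Nat.totient_prime Fact.out, Nat.card_zmod]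
  have hadd : Nat.card (NormalForm p) = Nat.card {t : NormalForm p // t.twist = 1} +
      Nat.card {t : NormalForm p // ¬ t.twist = 1} := by
    classical
    rw [← Nat.card_sum, Nat.card_congr (Equiv.sumCompl fun t : NormalForm p => t.twist = 1)]
  rw [htot, card_twist_eq_one] at hadd
  obtain ⟨q, rfl⟩ := Nat.exists_eq_add_of_le (Fact.out : p.Prime).two_le
  have h1 : 2 + q - 1 = q + 1 := by omega
  have h2 : 2 * (2 + q) - 1 = 2 * q + 3 := by omega
  have h3 : 2 * (2 + q) - 3 = 2 * q + 1 := by omega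
  rw [h1, h2] at hadd
  rw [h3]
  linarith

end Heisenberg

/-- Among regular subgroups `G` of `Hol(M₁)` with `|Θ(G)| = p²` there are
exactly `(2p − 3)p` conjugacy orbits of type `M₁` and exactly `2p − 1` orbits of elementary
abelian type. -/
theorem orbits_theta_p_sq (p : ℕ) [Fact p.Prime] (h3 : 3 < p) :
    Nat.card (Quot (fun (G G' : {G : Subgroup (Equiv.Perm (Heisenberg p)) //
        condM1 p (p ^ 2) G}) =>
      ∃ α : MulAut (Heisenberg p), autConj p α G.1 = G'.1)) = (2 * p - 3) * p ∧
    Nat.card (Quot (fun (G G' : {G : Subgroup (Equiv.Perm (Heisenberg p)) //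
        condEA p (p ^ 2) G}) =>
      ∃ α : MulAut (Heisenberg p), autConj p α G.1 = G'.1)) = 2 * p - 1 := by
  have h2 := two_ne_zero_of_gt h3
  have h3' := three_ne_zero_of_gt h3
  constructor
  · refine (card_orbits h2 (Heisenberg p)).trans ?_
    simp only [nonempty_mulEquiv_iff h2 h3']
    exact card_twist_ne_one
  · refine (card_orbits h2 (Multiplicative (ZMod p × ZMod p × ZMod p))).trans ?_
    simp only [nonempty_mulEquiv_prod_iff h2 h3']
    exact card_twist_eq_one
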